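/- Let X = [0,1] with Lebesgue measure, let q : [0,1]×[0,1] → [0,∞) be a measurable transition density with ∫₀¹ q(x,y) dy = 1 for every x, and let 𝒫 be the Perron–Frobenius operator of the Markov kernel p(x, A) = ∫_A q(x,y) dy, so that 𝒫μ has Lebesgue density y ↦ ∫ q(x,y) dμ(x). Fix κ ∈ (0,1], a > 0, N ≥ 1, J ≥ 1, and measurable likelihood functions g_j : [0,1] → [κ, κ⁻¹] for j = 0,…,J−1. Define the exact filtering measures by μ_{j+1} = L_{g_j} 𝒫 μ_j starting from a probability measure μ_0, and the Perron–Frobenius operator filter measures by μ^N_0 = μ_0 and μ^N_{j+1} = L_{g_j} ν̂_{j+1}, where ν̂_{j+1} is the probability measure with Lebesgue density π_N ρ̂_{j+1} and ρ̂_{j+1}(y) = ∫ q(x,y) dμ^N_j(x) is the density of 𝒫μ^N_j. Assume that ρ̂_{j+1} belongs to the discrete Lipschitz cone C_a for every 0 ≤ j ≤ J−1. Then d(μ^N_J, μ_J) ≤ Σ_{j=1}^{J} (2κ⁻²)^j · (e^a − 1)/(2N). -/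

import Mathlib

open MeasureTheory

/-- Total-variation distance between two measures:
`d(μ,ν) = (1/2)·sup{ |∫ f dμ − ∫ f dν| : f measurable, sup|f| ≤ 1 }`. -/
noncomputable def tvDist {X : Type*} [MeasurableSpace X] (μ ν : Measure X) : ℝ :=
  sSup {r : ℝ | ∃ f : X → ℝ, Measurable f ∧ (∀ x, |f x| ≤ 1) ∧
    r = (1 / 2) * |(∫ x, f x ∂μ) - ∫ x, f x ∂ν|}

/-- The likelihood operator `(L_g μ)(A) = (∫_A g dμ)/(∫_X g dμ)`. -/
noncomputable def likelihoodOp {X : Type*} [MeasurableSpace X] (g : X → ℝ) (μ : Measure X) :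
    Measure X :=
  ((μ.withDensity fun x => ENNReal.ofReal (g x)) Set.univ)⁻¹ •
    μ.withDensity fun x => ENNReal.ofReal (g x)

/-- The `i`-th Ulam box of the uniform partition of `[0,1]` into `N` pieces. -/
def ulamBox (N i : ℕ) : Set ℝ :=
  if i = N then Set.Icc (((N : ℝ) - 1) / N) 1
  else Set.Ico (((i : ℝ) - 1) / N) ((i : ℝ) / N)

/-- The Ulam projection `π_N f = Σ_{i=1}^N (N·∫_{B_i} f dx)·1_{B_i}`. -/
noncomputable def ulamProj (N : ℕ) (f : ℝ → ℝ) : ℝ → ℝ := fun x =>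
  ∑ i ∈ Finset.Icc 1 N, (ulamBox N i).indicator (fun _ => (N : ℝ) * ∫ y in ulamBox N i, f y) x

/-- The discrete Lipschitz cone `C_a` on `[0,1]`. -/
def lipCone (a : ℝ) (φ : ℝ → ℝ) : Prop :=
  (∀ x ∈ Set.Icc (0 : ℝ) 1, 0 < φ x) ∧
    ∀ x ∈ Set.Icc (0 : ℝ) 1, ∀ y ∈ Set.Icc (0 : ℝ) 1,
      φ x ≤ Real.exp (a * |x - y|) * φ y

lemma aux_lik_integral (g : ℝ → ℝ) (κ : ℝ) (hκ : κ ∈ Set.Ioc (0 : ℝ) 1) (hg : Measurable g)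
    (hgb : ∀ x, κ ≤ g x ∧ g x ≤ κ⁻¹) (μ : Measure ℝ) [IsProbabilityMeasure μ] :
    Integrable g μ ∧ κ ≤ ∫ x, g x ∂μ ∧ IsProbabilityMeasure (likelihoodOp g μ) ∧
    ∀ f : ℝ → ℝ, ∫ x, f x ∂(likelihoodOp g μ) = (∫ x, g x * f x ∂μ) / ∫ x, g x ∂μ := by
  have h0 : ∀ x, 0 ≤ g x := fun x => hκ.1.le.trans (hgb x).1
  have hint : Integrable g μ := by
    refine Integrable.of_bound hg.aestronglyMeasurable κ⁻¹ (Filter.Eventually.of_forall fun x => ?_)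
    rw [Real.norm_eq_abs, abs_of_nonneg (h0 x)]; exact (hgb x).2
  have hk : κ ≤ ∫ x, g x ∂μ := by
    have := integral_mono (integrable_const κ) hint (fun x => (hgb x).1)
    simpa using this
  have hpos : 0 < ∫ x, g x ∂μ := hκ.1.trans_le hk
  have hmass : (μ.withDensity fun x => ENNReal.ofReal (g x)) Set.univ
      = ENNReal.ofReal (∫ x, g x ∂μ) := by
    rw [withDensity_apply _ MeasurableSet.univ, Measure.restrict_univ,
      ofReal_integral_eq_lintegral_ofReal hint (Filter.Eventually.of_forall h0)]
  refine ⟨hint, hk, ⟨?_⟩, ?_⟩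
  · unfold likelihoodOp
    rw [Measure.smul_apply, hmass, smul_eq_mul]
    exact ENNReal.inv_mul_cancel (by simpa using hpos) ENNReal.ofReal_ne_top
  · intro f
    unfold likelihoodOp
    rw [integral_smul_measure, hmass, integral_withDensity_eq_integral_toReal_smul
      hg.ennreal_ofReal (Filter.Eventually.of_forall fun x => ENNReal.ofReal_lt_top)]
    rw [ENNReal.toReal_inv, ENNReal.toReal_ofReal hpos.le, smul_eq_mul, div_eq_inv_mul]
    congr 1
    refine integral_congr_ae (Filter.Eventually.of_forall fun x => ?_)
    simp [ENNReal.toReal_ofReal (h0 x)]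

/-- `|∫ f dμ - ∫ f dν| ≤ c` for all test functions. -/
def AuxD (μ ν : Measure ℝ) (c : ℝ) : Prop :=
  ∀ f : ℝ → ℝ, Measurable f → (∀ x, |f x| ≤ 1) → |(∫ x, f x ∂μ) - ∫ x, f x ∂ν| ≤ c

lemma aux_lik_D (g : ℝ → ℝ) (κ : ℝ) (hκ : κ ∈ Set.Ioc (0 : ℝ) 1) (hg : Measurable g)
    (hgb : ∀ x, κ ≤ g x ∧ g x ≤ κ⁻¹) (μ ν : Measure ℝ) [IsProbabilityMeasure μ]
    [IsProbabilityMeasure ν] (c : ℝ) (h : AuxD μ ν c) :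
    AuxD (likelihoodOp g μ) (likelihoodOp g ν) (2 * κ⁻¹ ^ 2 * c) := by
  obtain ⟨hiμ, hkμ, hpμ, hfμ⟩ := aux_lik_integral g κ hκ hg hgb μ
  obtain ⟨hiν, hkν, hpν, hfν⟩ := aux_lik_integral g κ hκ hg hgb ν
  intro f hf hf1
  have hκ0 := hκ.1
  have h0 : ∀ x, 0 ≤ g x := fun x => hκ.1.le.trans (hgb x).1
  have hc0 : 0 ≤ c := (abs_nonneg _).trans (h f hf hf1)
  have key : ∀ f : ℝ → ℝ, Measurable f → (∀ x, |f x| ≤ 1) →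
      |(∫ x, g x * f x ∂μ) - ∫ x, g x * f x ∂ν| ≤ κ⁻¹ * c := by
    intro f hf hf1
    have := h (fun x => κ * (g x * f x)) (by fun_prop) (fun x => by
      rw [abs_mul, abs_mul, abs_of_pos hκ0, abs_of_nonneg (h0 x)]
      have h1 : κ * g x ≤ 1 := by
        have := mul_le_mul_of_nonneg_left (hgb x).2 hκ0.le
        rwa [mul_inv_cancel₀ hκ0.ne'] at this
      have h2 := hf1 x
      have h3 := mul_nonneg hκ0.le (h0 x)
      have h4 := abs_nonneg (f x)
      nlinarith)
    rw [integral_const_mul, integral_const_mul, ← mul_sub, abs_mul, abs_of_pos hκ0] at this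
    rw [inv_mul_eq_div, le_div_iff₀ hκ0]; linarith
  have k1 := key f hf hf1
  have k2 := key (fun _ => 1) measurable_const (by simp)
  simp only [mul_one] at k2
  have hB : |∫ x, f x ∂(likelihoodOp g ν)| ≤ 1 := by
    have := norm_integral_le_of_norm_le_const (μ := likelihoodOp g ν) (f := f) (C := 1)
      (Filter.Eventually.of_forall hf1)
    simpa using this
  rw [hfμ, hfν]
  rw [hfν] at hB
  set A := ∫ x, g x * f x ∂μ
  set B := ∫ x, g x * f x ∂ν
  set m := ∫ x, g x ∂μ
  set n := ∫ x, g x ∂ν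
  have hm : 0 < m := hκ0.trans_le hkμ
  have hn : 0 < n := hκ0.trans_le hkν
  have e : A / m - B / n = ((A - B) - (B / n) * (m - n)) / m := by
    field_simp; ring
  rw [e, abs_div, abs_of_pos hm, div_le_iff₀ hm]
  have t : |(A - B) - (B / n) * (m - n)| ≤ κ⁻¹ * c + κ⁻¹ * c := by
    refine (abs_sub _ _).trans (add_le_add k1 ?_)
    rw [abs_mul]
    calc _ ≤ 1 * |m - n| := mul_le_mul_of_nonneg_right hB (abs_nonneg _)
      _ ≤ _ := by rw [one_mul]; exact k2
  have : κ⁻¹ * c + κ⁻¹ * c = 2 * κ⁻¹ ^ 2 * c * κ := by field_simp; ring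
  rw [this] at t
  exact t.trans (mul_le_mul_of_nonneg_left hkμ (by positivity))

/-- the measure on `[0,1]` with given density -/
noncomputable def auxDens (r : ℝ → ℝ) : Measure ℝ :=
  (volume.restrict (Set.Icc (0 : ℝ) 1)).withDensity fun y => ENNReal.ofReal (r y)

lemma aux_dens (r : ℝ → ℝ) (hr : Measurable r) (h0 : ∀ x ∈ Set.Icc (0 : ℝ) 1, 0 ≤ r x)
    (hi : IntegrableOn r (Set.Icc 0 1)) (h1 : ∫ y in Set.Icc (0 : ℝ) 1, r y = 1) :
    IsProbabilityMeasure (auxDens r) ∧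
    ∀ f : ℝ → ℝ, ∫ x, f x ∂(auxDens r) = ∫ y in Set.Icc (0 : ℝ) 1, r y * f y := by
  have h0' : ∀ᵐ x ∂(volume.restrict (Set.Icc (0 : ℝ) 1)), 0 ≤ r x :=
    (ae_restrict_iff' measurableSet_Icc).2 (Filter.Eventually.of_forall h0)
  refine ⟨⟨?_⟩, fun f => ?_⟩
  · unfold auxDens
    rw [withDensity_apply _ MeasurableSet.univ, Measure.restrict_univ,
      ← ofReal_integral_eq_lintegral_ofReal hi h0', h1]
    simp
  · unfold auxDens
    rw [integral_withDensity_eq_integral_toReal_smul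
      hr.ennreal_ofReal (Filter.Eventually.of_forall fun x => ENNReal.ofReal_lt_top)]
    refine integral_congr_ae ?_
    filter_upwards [h0'] with x hx
    simp [ENNReal.toReal_ofReal hx]

lemma aux_PF (q : ℝ → ℝ → ℝ) (hq_meas : Measurable (Function.uncurry q))
    (hq_nonneg : ∀ x y, 0 ≤ q x y)
    (hq_prob : ∀ x, (∫ y in Set.Icc (0 : ℝ) 1, q x y) = 1) (μ : Measure ℝ)
    [IsProbabilityMeasure μ] :
    Measurable (fun y => ∫ x, q x y ∂μ) ∧ (∀ y, 0 ≤ ∫ x, q x y ∂μ) ∧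
    IntegrableOn (fun y => ∫ x, q x y ∂μ) (Set.Icc 0 1) ∧
    (∫ y in Set.Icc (0 : ℝ) 1, ∫ x, q x y ∂μ) = 1 ∧
    ∀ f : ℝ → ℝ, Measurable f → (∀ x, |f x| ≤ 1) →
      ∫ y in Set.Icc (0 : ℝ) 1, (∫ x, q x y ∂μ) * f y
        = ∫ x, (∫ y in Set.Icc (0 : ℝ) 1, q x y * f y) ∂μ := by
  have hint : Integrable (Function.uncurry q) (μ.prod (volume.restrict (Set.Icc (0 : ℝ) 1))) := by
    rw [integrable_prod_iff hq_meas.aestronglyMeasurable]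
    constructor
    · refine Filter.Eventually.of_forall fun x => ?_
      by_contra hne
      have := integral_undef hne
      have h2 := hq_prob x
      simp only [Function.uncurry] at this
      rw [this] at h2
      exact zero_ne_one h2
    · have : (fun x => ∫ y, ‖Function.uncurry q (x, y)‖ ∂(volume.restrict (Set.Icc (0 : ℝ) 1)))
          = fun _ => 1 := by
        funext x
        refine Eq.trans ?_ (hq_prob x)
        refine integral_congr_ae (Filter.Eventually.of_forall fun y => ?_)
        simp [Function.uncurry, abs_of_nonneg (hq_nonneg x y)]
      rw [this]
      exact integrable_const _
  have hswap : ∀ f : ℝ → ℝ, Measurable f → (∀ x, |f x| ≤ 1) →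
      ∫ y in Set.Icc (0 : ℝ) 1, (∫ x, q x y ∂μ) * f y
        = ∫ x, (∫ y in Set.Icc (0 : ℝ) 1, q x y * f y) ∂μ := by
    intro f hf hf1
    rw [integral_integral_swap (f := fun x y => q x y * f y)]
    · refine integral_congr_ae (Filter.Eventually.of_forall fun y => ?_)
      exact (integral_mul_const _ _).symm
    · refine hint.mono ?_ (Filter.Eventually.of_forall fun p => ?_)
      · refine Measurable.aestronglyMeasurable ?_
        exact hq_meas.mul (hf.comp measurable_snd)
      · simp only [Function.uncurry, norm_mul]
        have := hf1 p.2
        exact mul_le_of_le_one_right (norm_nonneg _) this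
  refine ⟨?_, fun y => integral_nonneg fun x => hq_nonneg x y, hint.integral_prod_right, ?_, hswap⟩
  · have : StronglyMeasurable (fun p : ℝ × ℝ => q p.2 p.1) :=
      (hq_meas.comp measurable_swap).stronglyMeasurable
    exact (this.integral_prod_right' (ν := μ)).measurable
  · have := hswap (fun _ => 1) measurable_const (by simp)
    simp only [mul_one, hq_prob] at this
    rw [this]; simp

lemma aux_PF_D (q : ℝ → ℝ → ℝ) (hq_meas : Measurable (Function.uncurry q))
    (hq_nonneg : ∀ x y, 0 ≤ q x y)
    (hq_prob : ∀ x, (∫ y in Set.Icc (0 : ℝ) 1, q x y) = 1) (μ ν : Measure ℝ)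
    [IsProbabilityMeasure μ] [IsProbabilityMeasure ν] (c : ℝ) (h : AuxD μ ν c) :
    AuxD (auxDens fun y => ∫ x, q x y ∂μ) (auxDens fun y => ∫ x, q x y ∂ν) c := by
  obtain ⟨a1, a2, a3, a4, a5⟩ := aux_PF q hq_meas hq_nonneg hq_prob μ
  obtain ⟨b1, b2, b3, b4, b5⟩ := aux_PF q hq_meas hq_nonneg hq_prob ν
  intro f hf hf1
  rw [(aux_dens _ a1 (fun x _ => a2 x) a3 a4).2, (aux_dens _ b1 (fun x _ => b2 x) b3 b4).2,
    a5 f hf hf1, b5 f hf hf1]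
  apply h
  · have : StronglyMeasurable (fun p : ℝ × ℝ => q p.1 p.2 * f p.2) :=
      (hq_meas.mul (hf.comp measurable_snd)).stronglyMeasurable
    exact (this.integral_prod_right' (ν := volume.restrict (Set.Icc (0 : ℝ) 1))).measurable
  · intro x
    have hqi : Integrable (q x) (volume.restrict (Set.Icc (0 : ℝ) 1)) := by
      by_contra hne
      have := integral_undef hne
      rw [hq_prob x] at this
      exact one_ne_zero this
    have := norm_integral_le_of_norm_le (f := fun y => q x y * f y) hqi
      (Filter.Eventually.of_forall fun y => by
        rw [norm_mul, Real.norm_eq_abs, abs_of_nonneg (hq_nonneg x y)]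
        exact mul_le_of_le_one_right (hq_nonneg x y) (hf1 y))
    rw [hq_prob x] at this
    exact this

/-- index of the box containing `x` -/
noncomputable def auxIdx (N : ℕ) (x : ℝ) : ℕ := min (⌊(N : ℝ) * x⌋₊ + 1) N

lemma aux_box_iff (N : ℕ) (hN : 1 ≤ N) (i : ℕ) (hi : i ∈ Finset.Icc 1 N) (x : ℝ) :
    x ∈ ulamBox N i ↔ x ∈ Set.Icc (0 : ℝ) 1 ∧ i = auxIdx N x := by
  have hN0 : (0 : ℝ) < N := by exact_mod_cast hN
  rw [Finset.mem_Icc] at hi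
  obtain ⟨k, rfl⟩ : ∃ k, i = k + 1 := ⟨i - 1, by omega⟩
  unfold ulamBox auxIdx
  split_ifs with h
  · subst h
    push_cast
    rw [Set.mem_Icc, Set.mem_Icc, div_le_iff₀ (by positivity)]
    constructor
    · rintro ⟨h1, h2⟩
      have hx : 0 ≤ x := by
        by_contra hx; push Not at hx
        have : (0 : ℝ) ≤ k := by positivity
        nlinarith
      refine ⟨⟨hx, h2⟩, ?_⟩
      have : k ≤ ⌊((k : ℝ) + 1) * x⌋₊ := Nat.le_floor (by linarith)
      omega
    · rintro ⟨⟨h1, h2⟩, h3⟩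
      refine ⟨?_, h2⟩
      have h4 : k ≤ ⌊((k : ℝ) + 1) * x⌋₊ := by omega
      have := (Nat.le_floor_iff (by positivity)).1 h4
      linarith
  · rw [Set.mem_Ico, Set.mem_Icc, div_le_iff₀ hN0, lt_div_iff₀ hN0]
    push_cast
    have hkN : k + 1 < N := by omega
    have hkN' : (k : ℝ) + 1 < N := by exact_mod_cast hkN
    have hk0 : (0 : ℝ) ≤ k := by positivity
    constructor
    · rintro ⟨h1, h2⟩
      have hx : 0 ≤ x := by
        by_contra hx; push Not at hx
        nlinarith
      refine ⟨⟨hx, by nlinarith⟩, ?_⟩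
      have : ⌊(N : ℝ) * x⌋₊ = k := by
        rw [Nat.floor_eq_iff (by positivity)]; constructor <;> linarith
      omega
    · rintro ⟨⟨h1, h2⟩, h3⟩
      have : ⌊(N : ℝ) * x⌋₊ = k := by omega
      rw [Nat.floor_eq_iff (by positivity)] at this
      constructor <;> linarith [this.1, this.2]

lemma aux_idx_mem (N : ℕ) (hN : 1 ≤ N) (x : ℝ) : auxIdx N x ∈ Finset.Icc 1 N := by
  unfold auxIdx
  rw [Finset.mem_Icc]; omega

lemma aux_box_meas (N i : ℕ) : MeasurableSet (ulamBox N i) := by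
  unfold ulamBox
  split_ifs
  · exact measurableSet_Icc
  · exact measurableSet_Ico

lemma aux_box_vol (N : ℕ) (hN : 1 ≤ N) (i : ℕ) : volume.real (ulamBox N i) = 1 / N := by
  have hN0 : (0 : ℝ) < N := by exact_mod_cast hN
  unfold ulamBox
  split_ifs
  · rw [Real.volume_real_Icc_of_le (by rw [div_le_one hN0]; linarith)]
    field_simp; ring
  · rw [Real.volume_real_Ico_of_le (by gcongr; linarith)]
    field_simp; ring

lemma aux_box_diam (N : ℕ) (hN : 1 ≤ N) (i : ℕ) (x y : ℝ) (hx : x ∈ ulamBox N i)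
    (hy : y ∈ ulamBox N i) : |x - y| ≤ 1 / N := by
  have hN0 : (0 : ℝ) < N := by exact_mod_cast hN
  unfold ulamBox at hx hy
  split_ifs at hx hy
  · have e : ((N : ℝ) - 1) / N = 1 - 1 / N := by field_simp
    rw [e] at hx hy
    rw [abs_le]; constructor <;> linarith [hx.1, hx.2, hy.1, hy.2]
  · have e : ((i : ℝ) - 1) / N = i / N - 1 / N := by field_simp
    rw [e] at hx hy
    rw [abs_le]; constructor <;> linarith [hx.1, hx.2, hy.1, hy.2]

lemma aux_proj_eq (N : ℕ) (hN : 1 ≤ N) (f : ℝ → ℝ) (x : ℝ) (hx : x ∈ Set.Icc (0 : ℝ) 1) :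
    ulamProj N f x = (N : ℝ) * ∫ y in ulamBox N (auxIdx N x), f y := by
  unfold ulamProj
  rw [Finset.sum_eq_single_of_mem _ (aux_idx_mem N hN x)]
  · rw [Set.indicator_of_mem]
    exact (aux_box_iff N hN _ (aux_idx_mem N hN x) x).2 ⟨hx, rfl⟩
  · intro i hi hne
    rw [Set.indicator_of_notMem]
    intro hmem
    exact hne ((aux_box_iff N hN i hi x).1 hmem).2

lemma aux_proj_meas (N : ℕ) (f : ℝ → ℝ) : Measurable (ulamProj N f) := by
  unfold ulamProj
  exact Finset.measurable_sum _ fun i _ => measurable_const.indicator (aux_box_meas N i)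

lemma aux_proj_int (N : ℕ) (hN : 1 ≤ N) (f : ℝ → ℝ) (hf : IntegrableOn f (Set.Icc 0 1)) :
    IntegrableOn (ulamProj N f) (Set.Icc 0 1) ∧
    ∫ y in Set.Icc (0 : ℝ) 1, ulamProj N f y = ∫ y in Set.Icc (0 : ℝ) 1, f y := by
  have hN0 : (0 : ℝ) < N := by exact_mod_cast hN
  have hI : ∀ i ∈ Finset.Icc 1 N, Integrable ((ulamBox N i).indicator
      (fun _ => (N : ℝ) * ∫ y in ulamBox N i, f y)) (volume.restrict (Set.Icc (0 : ℝ) 1)) :=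
    fun i _ => (integrable_const _).indicator (aux_box_meas N i)
  have hsub : ∀ i ∈ Finset.Icc 1 N, ulamBox N i ⊆ Set.Icc 0 1 :=
    fun i hi x hx => ((aux_box_iff N hN i hi x).1 hx).1
  constructor
  · unfold ulamProj
    exact integrable_finsetSum _ hI
  · unfold ulamProj
    rw [integral_finsetSum _ hI]
    have hU : Set.Icc (0 : ℝ) 1 = ⋃ i ∈ Finset.Icc 1 N, ulamBox N i := by
      ext x
      simp only [Set.mem_iUnion]
      constructor
      · intro hx
        exact ⟨auxIdx N x, aux_idx_mem N hN x,
          (aux_box_iff N hN _ (aux_idx_mem N hN x) x).2 ⟨hx, rfl⟩⟩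
      · rintro ⟨i, hi, hx⟩
        exact hsub i hi hx
    have hsum : ∫ y in Set.Icc (0 : ℝ) 1, f y
        = ∑ i ∈ Finset.Icc 1 N, ∫ y in ulamBox N i, f y := by
      conv_lhs => rw [hU]
      refine integral_biUnion_finset _ (fun i _ => aux_box_meas N i) ?_
        (fun i hi => hf.mono_set (hsub i hi))
      intro i hi j hj hij
      refine Set.disjoint_left.2 fun x hx hy => hij ?_
      rw [((aux_box_iff N hN i hi x).1 hx).2]
      exact ((aux_box_iff N hN j hj x).1 hy).2.symm
    rw [hsum]
    refine Finset.sum_congr rfl fun i hi => ?_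
    rw [integral_indicator (aux_box_meas N i), Measure.restrict_restrict (aux_box_meas N i),
      Set.inter_eq_left.2 (hsub i hi), setIntegral_const, aux_box_vol N hN, smul_eq_mul]
    field_simp

lemma aux_proj_close (N : ℕ) (hN : 1 ≤ N) (a : ℝ) (ha : 0 < a) (f : ℝ → ℝ)
    (hf : IntegrableOn f (Set.Icc 0 1)) (hc : lipCone a f) (x : ℝ) (hx : x ∈ Set.Icc (0 : ℝ) 1) :
    0 ≤ ulamProj N f x ∧ |ulamProj N f x - f x| ≤ (Real.exp a - 1) / N * f x := by
  have hN0 : (0 : ℝ) < N := by exact_mod_cast hN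
  rw [aux_proj_eq N hN f x hx]
  set i := auxIdx N x with hi
  have him : i ∈ Finset.Icc 1 N := aux_idx_mem N hN x
  have hxi : x ∈ ulamBox N i := (aux_box_iff N hN i him x).2 ⟨hx, rfl⟩
  have hsub : ulamBox N i ⊆ Set.Icc 0 1 := fun x hx => ((aux_box_iff N hN i him x).1 hx).1
  have hfi := hf.mono_set hsub
  set E := Real.exp (a / N) with hE
  have hE1 : 1 ≤ E := Real.one_le_exp (by positivity)
  have hpair : ∀ y ∈ ulamBox N i, ∀ z ∈ ulamBox N i, f y ≤ E * f z := by
    intro y hy z hz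
    refine (hc.2 y (hsub hy) z (hsub hz)).trans ?_
    refine mul_le_mul_of_nonneg_right (Real.exp_le_exp.2 ?_) (hc.1 z (hsub hz)).le
    have := mul_le_mul_of_nonneg_left (aux_box_diam N hN i y z hy hz) ha.le
    rwa [mul_one_div] at this
  have hvol : volume (ulamBox N i) ≠ ⊤ :=
    ((measure_mono hsub).trans_lt (by simp)).ne
  have hconst : ∀ c : ℝ, (N : ℝ) * ∫ y in ulamBox N i, c = c := by
    intro c
    rw [setIntegral_const, aux_box_vol N hN, smul_eq_mul]; field_simp
  have hup : (N : ℝ) * ∫ y in ulamBox N i, f y ≤ E * f x := by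
    rw [← hconst (E * f x)]
    refine mul_le_mul_of_nonneg_left ?_ hN0.le
    exact setIntegral_mono_on hfi (integrableOn_const hvol) (aux_box_meas N i)
      (fun y hy => hpair y hy x hxi)
  have hlo : f x ≤ E * ((N : ℝ) * ∫ y in ulamBox N i, f y) := by
    rw [mul_left_comm, ← integral_const_mul]
    conv_lhs => rw [← hconst (f x)]
    refine mul_le_mul_of_nonneg_left ?_ hN0.le
    exact setIntegral_mono_on (integrableOn_const hvol) (hfi.const_mul E) (aux_box_meas N i)
      (fun y hy => hpair x hxi y hy)
  set A := (N : ℝ) * ∫ y in ulamBox N i, f y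
  have hfx := hc.1 x hx
  have hA : 0 ≤ A := by
    by_contra hA; push Not at hA
    nlinarith
  refine ⟨hA, ?_⟩
  have hEN : E - 1 ≤ (Real.exp a - 1) / N := by
    have hpow : Real.exp a = E ^ N := by
      rw [hE, ← Real.exp_nat_mul]; congr 1; field_simp
    have hb := one_add_mul_le_pow (a := E - 1) (by linarith) N
    rw [le_div_iff₀ hN0, hpow]
    have : (1 + (E - 1)) ^ N = E ^ N := by ring
    linarith
  have hmain : |A - f x| ≤ (E - 1) * f x := by
    rw [abs_le]
    constructor
    · by_cases hle : A ≤ f x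
      · nlinarith
      · push Not at hle; nlinarith
    · linarith
  exact hmain.trans (mul_le_mul_of_nonneg_right hEN hfx.le)

lemma aux_ulam (N : ℕ) (hN : 1 ≤ N) (a : ℝ) (ha : 0 < a) (r : ℝ → ℝ) (hr : Measurable r)
    (hi : IntegrableOn r (Set.Icc 0 1)) (h1 : ∫ y in Set.Icc (0 : ℝ) 1, r y = 1)
    (hc : lipCone a r) :
    IsProbabilityMeasure (auxDens (ulamProj N r)) ∧
    AuxD (auxDens (ulamProj N r)) (auxDens r) ((Real.exp a - 1) / N) := by
  have hcl := aux_proj_close N hN a ha r hi hc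
  obtain ⟨pi1, pi2⟩ := aux_proj_int N hN r hi
  obtain ⟨P1, P2⟩ := aux_dens (ulamProj N r) (aux_proj_meas N r) (fun x hx => (hcl x hx).1) pi1
    (pi2.trans h1)
  obtain ⟨R1, R2⟩ := aux_dens r hr (fun x hx => (hc.1 x hx).le) hi h1
  refine ⟨P1, fun f hf hf1 => ?_⟩
  have hb : ∀ s : ℝ → ℝ, IntegrableOn s (Set.Icc 0 1) →
      IntegrableOn (fun y => s y * f y) (Set.Icc 0 1) := fun s hs =>
    Integrable.mul_bdd (c := 1) hs hf.aestronglyMeasurable (Filter.Eventually.of_forall hf1)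
  rw [P2, R2, ← integral_sub (hb _ pi1) (hb _ hi)]
  have := norm_integral_le_of_norm_le (μ := volume.restrict (Set.Icc (0 : ℝ) 1))
    (f := fun y => ulamProj N r y * f y - r y * f y)
    (hi.const_mul ((Real.exp a - 1) / N))
    ((ae_restrict_iff' measurableSet_Icc).2 (Filter.Eventually.of_forall fun y hy => by
        rw [← sub_mul, norm_mul]
        exact (mul_le_of_le_one_right (norm_nonneg _) (hf1 y)).trans (hcl y hy).2))
  rw [integral_const_mul, h1, mul_one] at this
  exact this

/-- Convergence of the Perron–Frobenius operator filter: on `X = [0,1]` with transition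
density `q`, exact filter `μ_{j+1} = L_{g_j} 𝒫 μ_j` and PFOF `μ^N_{j+1} = L_{g_j} ν̂_{j+1}`
(where `ν̂_{j+1}` has density `π_N ρ̂_{j+1}` and `ρ̂_{j+1}` is the density of `𝒫 μ^N_j`),
if each `ρ̂_{j+1} ∈ C_a` and `κ ≤ g_j ≤ κ⁻¹`, then
`d(μ^N_J, μ_J) ≤ Σ_{j=1}^J (2κ⁻²)^j·(e^a − 1)/(2N)`. -/
theorem pfof_convergence
    (q : ℝ → ℝ → ℝ) (hq_meas : Measurable (Function.uncurry q))
    (hq_nonneg : ∀ x y, 0 ≤ q x y)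
    (hq_prob : ∀ x, (∫ y in Set.Icc (0 : ℝ) 1, q x y) = 1)
    (PF : Measure ℝ → Measure ℝ)
    (hPF : ∀ μ' : Measure ℝ, PF μ' =
      (volume.restrict (Set.Icc (0 : ℝ) 1)).withDensity
        fun y => ENNReal.ofReal (∫ x, q x y ∂μ'))
    (κ : ℝ) (hκ : κ ∈ Set.Ioc (0 : ℝ) 1) (a : ℝ) (ha : 0 < a)
    (N : ℕ) (hN : 1 ≤ N) (J : ℕ) (hJ : 1 ≤ J)
    (g : ℕ → ℝ → ℝ) (hg : ∀ j, Measurable (g j))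
    (hgb : ∀ j x, κ ≤ g j x ∧ g j x ≤ κ⁻¹)
    (μ0 : Measure ℝ) [IsProbabilityMeasure μ0]
    (μ : ℕ → Measure ℝ) (hμ0 : μ 0 = μ0)
    (hμ : ∀ j, μ (j + 1) = likelihoodOp (g j) (PF (μ j)))
    (μN : ℕ → Measure ℝ) (hμN0 : μN 0 = μ0)
    (ρhat : ℕ → ℝ → ℝ)
    (hρhat : ∀ j, ρhat (j + 1) = fun y => ∫ x, q x y ∂(μN j))
    (hμN : ∀ j, μN (j + 1) = likelihoodOp (g j)
      ((volume.restrict (Set.Icc (0 : ℝ) 1)).withDensity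
        fun y => ENNReal.ofReal (ulamProj N (ρhat (j + 1)) y)))
    (hcone : ∀ j < J, lipCone a (ρhat (j + 1))) :
    tvDist (μN J) (μ J) ≤
      ∑ j ∈ Finset.Icc 1 J, (2 * κ⁻¹ ^ 2) ^ j * ((Real.exp a - 1) / (2 * N)) := by
  set δ : ℝ := (Real.exp a - 1) / (2 * N) with hδ
  have hN0 : (0 : ℝ) < N := by exact_mod_cast hN
  have hδ2 : (Real.exp a - 1) / N = 2 * δ := by rw [hδ]; field_simp
  have main : ∀ j ≤ J, IsProbabilityMeasure (μ j) ∧ IsProbabilityMeasure (μN j) ∧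
      AuxD (μN j) (μ j) (2 * ∑ i ∈ Finset.Icc 1 j, (2 * κ⁻¹ ^ 2) ^ i * δ) := by
    intro j
    induction j with
    | zero =>
      intro _
      rw [hμ0, hμN0]
      exact ⟨inferInstance, inferInstance, fun f _ _ => by simp⟩
    | succ j ih =>
      intro hj
      obtain ⟨p1, p2, hD⟩ := ih (by omega)
      obtain ⟨a1, a2, a3, a4, a5⟩ := aux_PF q hq_meas hq_nonneg hq_prob (μ j)
      obtain ⟨b1, b2, b3, b4, b5⟩ := aux_PF q hq_meas hq_nonneg hq_prob (μN j)
      have hP := (aux_dens _ a1 (fun x _ => a2 x) a3 a4).1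
      have hDP := aux_PF_D q hq_meas hq_nonneg hq_prob (μN j) (μ j) _ hD
      have hcj := hcone j (by omega)
      have e1 : μN (j + 1) = likelihoodOp (g j) (auxDens (ulamProj N (ρhat (j + 1)))) := hμN j
      have e2 : μ (j + 1) = likelihoodOp (g j) (auxDens fun y => ∫ x, q x y ∂(μ j)) := by
        rw [hμ j, hPF]; rfl
      rw [hρhat j] at hcj e1
      obtain ⟨u1, u2⟩ := aux_ulam N hN a ha _ b1 b3 b4 hcj
      rw [e1, e2]
      refine ⟨(aux_lik_integral (g j) κ hκ (hg j) (hgb j) _).2.2.1,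
        (aux_lik_integral (g j) κ hκ (hg j) (hgb j) _).2.2.1, ?_⟩
      have hD3 : AuxD (auxDens (ulamProj N fun y => ∫ x, q x y ∂(μN j)))
          (auxDens fun y => ∫ x, q x y ∂(μ j))
          (2 * δ + 2 * ∑ i ∈ Finset.Icc 1 j, (2 * κ⁻¹ ^ 2) ^ i * δ) := by
        intro f hf hf1
        rw [← hδ2]
        exact (abs_sub_le _ _ _).trans (add_le_add (u2 f hf hf1) (hDP f hf hf1))
      have hD4 := aux_lik_D (g j) κ hκ (hg j) (hgb j) _ _ _ hD3
      have hs : ∀ (c : ℝ) (n : ℕ), ∑ i ∈ Finset.Icc 1 (n + 1), c ^ i * δ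
          = c * (δ + ∑ i ∈ Finset.Icc 1 n, c ^ i * δ) := by
        intro c n
        induction n with
        | zero => simp
        | succ n ihn =>
          have h2 := Finset.sum_Icc_succ_top (a := 1) (b := n) (by omega) (fun i => c ^ i * δ)
          rw [Finset.sum_Icc_succ_top (b := n + 1) (by omega)]
          linear_combination ihn - c * h2
      rw [hs]
      convert hD4 using 1
      ring
  obtain ⟨_, _, hD⟩ := main J le_rfl
  unfold tvDist
  refine csSup_le ⟨_, fun _ => 0, measurable_const, by simp, rfl⟩ ?_
  rintro r ⟨f, hf, hf1, rfl⟩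
  have := hD f hf hf1
  linarith
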